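/- arXiv:2305.14329 — 2 statements merged into one kernel-verified Lean document; each statement's English description precedes it below -/
import Mathlib

section
/- Let Γ be an infinite-horizon discounted zero-sum polymatrix Markov game. Then: (i) the program P_NE' is feasible; (ii) every feasible point (π, w) has objective value Σ_{k ∈ [n]} Σ_s ρ(s) ( w_k(s) − V^π_k(s) ) = Σ_{k ∈ [n]} Σ_s ρ(s) w_k(s) ≥ 0; and (iii) the global minimum value of P_NE' equals 0, attained by taking π a stationary Nash equilibrium product policy of Γ and w_k(s) = V^{†,π_{−k}}_k(s). -/
open Finset

section InfiniteHorizon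

variable {n : ℕ} {S : Type*} [Fintype S] [DecidableEq S] {A : Fin n → Type*}
  [∀ k, Fintype (A k)] [∀ k, DecidableEq (A k)]

/-- `f` is a probability distribution on the finite type `α`. -/
def IsDist {α : Type*} [Fintype α] (f : α → ℝ) : Prop :=
  (∀ x, 0 ≤ f x) ∧ ∑ x, f x = 1

/-- A stationary Markov policy: a distribution on `α` for every state. -/
def IsStatPol {S : Type*} {α : Type*} [Fintype α] (π : S → α → ℝ) : Prop :=
  ∀ s : S, IsDist (π s)

/-- A valid (stationary) transition kernel. -/
def IsKer (P : S → (∀ k, A k) → S → ℝ) : Prop :=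
  ∀ s a, IsDist (P s a)

/-- Rewards take values in `[-1, 1]`. -/
def IsRew (r : Fin n → S → (∀ k, A k) → ℝ) : Prop :=
  ∀ k s a, r k s a ∈ Set.Icc (-1 : ℝ) 1

/-- `h`-step state-to-state transition matrix under the joint policy `σ`. -/
noncomputable def matPow (P : S → (∀ k, A k) → S → ℝ)
    (σ : S → (∀ k, A k) → ℝ) : ℕ → S → S → ℝ
  | 0 => fun s s' => if s = s' then 1 else 0
  | h + 1 => fun s s' => ∑ t, matPow P σ h s t * ∑ a, σ t a * P t a s'

/-- Expected one-step reward under `σ`. -/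
noncomputable def expRew (σ : S → (∀ k, A k) → ℝ)
    (rk : S → (∀ k, A k) → ℝ) (s : S) : ℝ :=
  ∑ a, σ s a * rk s a

/-- `vinf γ P rk σ s` is the expected `γ`-discounted infinite-horizon reward
`V^σ(s) = E[∑ₕ γ^(h-1) r(s_h, a_h)]`, started at state `s`. -/
noncomputable def vinf (γ : ℝ) (P : S → (∀ k, A k) → S → ℝ)
    (rk : S → (∀ k, A k) → ℝ) (σ : S → (∀ k, A k) → ℝ) (s : S) : ℝ :=
  ∑' h : ℕ, γ ^ h * ∑ s', matPow P σ h s s' * expRew σ rk s'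

/-- Value under the initial distribution `ρ`. -/
noncomputable def vinfρ (γ : ℝ) (P : S → (∀ k, A k) → S → ℝ)
    (rk : S → (∀ k, A k) → ℝ) (σ : S → (∀ k, A k) → ℝ) (ρ : S → ℝ) : ℝ :=
  ∑ s, ρ s * vinf γ P rk σ s

/-- The joint stationary policy in which player `k` plays `π'` independently
against the marginal `σ₋ₖ` of the joint policy `σ`. -/
noncomputable def deviateI (k : Fin n) (π' : S → A k → ℝ)
    (σ : S → (∀ j, A j) → ℝ) : S → (∀ j, A j) → ℝ :=
  fun s a => π' s (a k) * ∑ b : A k, σ s (Function.update a k b)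

/-- The marginal stationary policy of player `k` induced by `σ`. -/
noncomputable def marginalI (σ : S → (∀ j, A j) → ℝ) (k : Fin n) :
    S → A k → ℝ :=
  fun s b => ∑ a : ∀ j, A j, if a k = b then σ s a else 0

/-- The product policy induced by individual stationary policies `π k`. -/
def prodPolI (π : ∀ k, S → A k → ℝ) : S → (∀ j, A j) → ℝ :=
  fun s a => ∏ k, π k s (a k)

/-- `σ` is an `ε`-approximate CCE of the discounted game (w.r.t. `ρ`). -/
def IsCCEI (γ : ℝ) (P : S → (∀ k, A k) → S → ℝ)
    (r : Fin n → S → (∀ k, A k) → ℝ) (ρ : S → ℝ) (ε : ℝ)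
    (σ : S → (∀ k, A k) → ℝ) : Prop :=
  ∀ k : Fin n, ∀ π' : S → A k → ℝ, IsStatPol π' →
    vinfρ γ P (r k) (deviateI k π' σ) ρ - vinfρ γ P (r k) σ ρ ≤ ε

/-- The stationary product policy `π` is an `ε`-approximate NE (w.r.t. `ρ`). -/
def IsNEI (γ : ℝ) (P : S → (∀ k, A k) → S → ℝ)
    (r : Fin n → S → (∀ k, A k) → ℝ) (ρ : S → ℝ) (ε : ℝ)
    (π : ∀ k, S → A k → ℝ) : Prop :=
  ∀ k : Fin n, ∀ π' : S → A k → ℝ, IsStatPol π' →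
    vinfρ γ P (r k) (deviateI k π' (prodPolI π)) ρ -
      vinfρ γ P (r k) (prodPolI π) ρ ≤ ε

/-- `v` is the best-response value `V^{†,σ₋ₖ}_k(s)` of player `k` against `σ`. -/
def IsBRValI (γ : ℝ) (P : S → (∀ k, A k) → S → ℝ)
    (rk : S → (∀ k, A k) → ℝ) (σ : S → (∀ k, A k) → ℝ)
    (k : Fin n) (s : S) (v : ℝ) : Prop :=
  IsGreatest {x : ℝ | ∃ π' : S → A k → ℝ, IsStatPol π' ∧
    x = vinf γ P rk (deviateI k π' σ) s} v

/-- The game is zero-sum polymatrix. -/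
def IsZSPolymatrixI (r : Fin n → S → (∀ k, A k) → ℝ) : Prop :=
  (∀ s a, ∑ k, r k s a = 0) ∧
  ∃ q : (k : Fin n) → (j : Fin n) → S → A k → A j → ℝ,
    (∀ k j s x y, q k j s x y ∈ Set.Icc (-1 : ℝ) 1) ∧
    ∀ k s a, r k s a = ∑ j ∈ univ.filter (fun j => j ≠ k), q k j s (a k) (a j)

/-- Switching control: at every state a single player controls the transition. -/
def SwitchingControlI (P : S → (∀ k, A k) → S → ℝ) : Prop :=
  ∀ s : S, ∃ k : Fin n, ∀ a a' : ∀ j, A j, a k = a' k → P s a = P s a'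

/-- Feasibility for the nonlinear program `P_NE'`. -/
def FeasNEI (γ : ℝ) (P : S → (∀ k, A k) → S → ℝ)
    (r : Fin n → S → (∀ k, A k) → ℝ)
    (π : ∀ k, S → A k → ℝ) (w : Fin n → S → ℝ) : Prop :=
  (∀ k, IsStatPol (π k)) ∧
  ∀ k : Fin n, ∀ s, ∀ b : A k,
    (∑ a : ∀ j, A j, if a k = b then
        (∏ j ∈ univ.filter (fun j => j ≠ k), π j s (a j)) *
          (r k s a + γ * ∑ s', P s a s' * w k s')
      else 0) ≤ w k s

/-- Objective of the nonlinear program `P_NE'`. -/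
noncomputable def objNEI (γ : ℝ) (P : S → (∀ k, A k) → S → ℝ)
    (r : Fin n → S → (∀ k, A k) → ℝ) (ρ : S → ℝ)
    (π : ∀ k, S → A k → ℝ) (w : Fin n → S → ℝ) : ℝ :=
  ∑ k, ∑ s, ρ s * (w k s - vinf γ P (r k) (prodPolI π) s)

/-- Feasibility for the best-response linear program `P_BR'(σ̂)`. -/
def FeasBRI (γ : ℝ) (P : S → (∀ k, A k) → S → ℝ)
    (r : Fin n → S → (∀ k, A k) → ℝ)
    (σ' : S → (∀ k, A k) → ℝ) (w : Fin n → S → ℝ) : Prop :=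
  ∀ k : Fin n, ∀ s, ∀ b : A k,
    (∑ a : ∀ j, A j, if a k = b then
        (∑ b' : A k, σ' s (Function.update a k b')) *
          (r k s a + γ * ∑ s', P s a s' * w k s')
      else 0) ≤ w k s

/-- Objective of the best-response linear program `P_BR'(σ̂)`. -/
noncomputable def objBRI (γ : ℝ) (P : S → (∀ k, A k) → S → ℝ)
    (r : Fin n → S → (∀ k, A k) → ℝ) (ρ : S → ℝ)
    (σ' : S → (∀ k, A k) → ℝ) (w : Fin n → S → ℝ) : ℝ :=
  ∑ k, ∑ s, ρ s * (w k s - vinf γ P (r k) σ' s)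

end InfiniteHorizon
section Brouwer

open MeasureTheory Metric Set Topology Polynomial
open scoped NNReal ContDiff

variable {E : Type*} [NormedAddCommGroup E] [InnerProductSpace ℝ E] [FiniteDimensional ℝ E]

/-- The determinant of `id + t • L` is a polynomial in `t`, of degree at most the dimension. -/
theorem exists_polynomial_eval_eq_det_id_add_smul (L : E →L[ℝ] E) :
    ∃ q : ℝ[X], q.natDegree ≤ Module.finrank ℝ E ∧
      ∀ t : ℝ, q.eval t = (ContinuousLinearMap.id ℝ E + t • L).det := by
  classical
  let b := Module.finBasis ℝ E
  let M := LinearMap.toMatrix b b L.toLinearMap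
  refine ⟨((X : ℝ[X]) • M.map C + (1 : Matrix _ _ ℝ).map C).det, ?_, fun t => ?_⟩
  · simpa using Polynomial.natDegree_det_X_add_C_le M 1
  · rw [ContinuousLinearMap.det, ← LinearMap.det_toMatrix b, ← Polynomial.coe_evalRingHom,
      RingHom.map_det]
    congr 1
    ext i j
    rcases eq_or_ne i j with rfl | hij
    · simp [M, LinearMap.toMatrix_apply, mul_comm _ t, add_comm]
    · simp [M, LinearMap.toMatrix_apply, hij, mul_comm _ t]

theorem det_id_add_smul_pos (L : E →L[ℝ] E) {t : ℝ} (ht : 0 ≤ t) (hL : t * ‖L‖ < 1) :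
    0 < (ContinuousLinearMap.id ℝ E + t • L).det := by
  have hne : ∀ u ∈ Icc 0 t, (ContinuousLinearMap.id ℝ E + u • L).det ≠ 0 := by
    intro u hu h0
    have hlt : (⊥ : Submodule ℝ E) <
        LinearMap.ker (ContinuousLinearMap.id ℝ E + u • L).toLinearMap :=
      LinearMap.bot_lt_ker_of_det_eq_zero h0
    obtain ⟨v, hv, hv0⟩ := Submodule.exists_mem_ne_zero_of_ne_bot hlt.ne'
    have hv' : v = -(u • L v) := by
      have : v + u • L v = 0 := by simpa using hv
      exact eq_neg_of_add_eq_zero_left this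
    have h1 : ‖v‖ ≤ u * ‖L‖ * ‖v‖ := by
      calc ‖v‖ = u * ‖L v‖ := by
            conv_lhs => rw [hv']
            rw [norm_neg, norm_smul, Real.norm_of_nonneg hu.1]
        _ ≤ u * (‖L‖ * ‖v‖) := mul_le_mul_of_nonneg_left (L.le_opNorm v) hu.1
        _ = _ := by ring
    have h2 : u * ‖L‖ ≤ t * ‖L‖ := mul_le_mul_of_nonneg_right hu.2 (norm_nonneg _)
    nlinarith [norm_pos_iff.2 hv0]
  have hc : ContinuousOn (fun u : ℝ => (ContinuousLinearMap.id ℝ E + u • L).det) (Icc 0 t) :=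
    (ContinuousLinearMap.continuous_det.comp (by fun_prop)).continuousOn
  by_contra! h
  obtain ⟨u, hu, hu0⟩ := intermediate_value_Icc' ht hc ⟨h, by simp [ContinuousLinearMap.det]⟩
  exact hne u hu hu0

/-- A contraction vanishing on the unit sphere, added to the identity, maps the open unit ball
bijectively onto itself, as soon as it preserves the ball. -/
theorem image_ball_id_add_eq_ball {h : E → E} {K : ℝ≥0}
    (hK : LipschitzOnWith K h (closedBall 0 1)) (hK1 : K < 1) (h0 : ∀ x ∈ sphere (0 : E) 1, h x = 0)
    (hmaps : MapsTo (fun x => x + h x) (ball 0 1) (ball 0 1)) :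
    InjOn (fun x => x + h x) (ball 0 1) ∧ (fun x => x + h x) '' ball 0 1 = ball 0 1 := by
  have happ : ApproximatesLinearOn (fun x => x + h x)
      ((ContinuousLinearEquiv.refl ℝ E : E ≃L[ℝ] E) : E →L[ℝ] E) (ball 0 1) K := by
    rw [ApproximatesLinearOn.approximatesLinearOn_iff_lipschitzOnWith]
    convert! hK.mono ball_subset_closedBall using 1
    ext x
    simp
  have hc : Subsingleton E ∨
      K < ‖((ContinuousLinearEquiv.refl ℝ E).symm : E →L[ℝ] E)‖₊⁻¹ := by
    rcases subsingleton_or_nontrivial E with hs | hs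
    · exact Or.inl hs
    · right
      have : ‖((ContinuousLinearEquiv.refl ℝ E).symm : E →L[ℝ] E)‖₊ = 1 :=
        ContinuousLinearMap.nnnorm_id
      simpa [this] using hK1
  refine ⟨happ.injOn hc, (hmaps.image_subset).antisymm ?_⟩
  have hopen : IsOpen ((fun x => x + h x) '' ball 0 1) :=
    happ.open_image (ContinuousLinearEquiv.refl ℝ E).toNonlinearRightInverse isOpen_ball hc
  refine (convex_ball (0 : E) 1).isPreconnected.subset_of_closure_inter_subset hopen ?_ ?_
  · have hm : (0 : E) ∈ ball (0 : E) 1 := mem_ball_self one_pos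
    exact ⟨_, hmaps hm, mem_image_of_mem _ hm⟩
  · rintro y ⟨hy, hyb⟩
    have hcomp : IsCompact ((fun x => x + h x) '' closedBall 0 1) :=
      (isCompact_closedBall 0 1).image_of_continuousOn (continuousOn_id.add hK.continuousOn)
    obtain ⟨x, hx, rfl⟩ :=
      closure_minimal (image_mono ball_subset_closedBall) hcomp.isClosed hy
    rcases (mem_closedBall.1 hx).lt_or_eq with hlt | heq
    · exact mem_image_of_mem _ hlt
    · simp only [h0 x heq, add_zero] at hyb
      exact absurd hyb (by simp [heq])

/-- There is no `C¹` retraction of the closed unit ball onto the unit sphere. -/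
theorem not_exists_contDiffOn_retraction [MeasurableSpace E] [BorelSpace E] {r : E → E}
    {U : Set E} (hU : IsOpen U) (hBU : closedBall 0 1 ⊆ U) (hr : ContDiffOn ℝ 1 r U)
    (hnorm : ∀ x ∈ closedBall (0 : E) 1, ‖r x‖ = 1) (hfix : ∀ x ∈ sphere (0 : E) 1, r x = x) :
    False := by
  set h : E → E := fun x => r x - x with hh
  have hcd : ContDiffOn ℝ 1 h U := hr.sub contDiffOn_id
  have hdiff : ∀ x ∈ closedBall (0 : E) 1, DifferentiableAt ℝ h x := fun x hx =>
    (hcd.differentiableOn one_ne_zero).differentiableAt (hU.mem_nhds (hBU hx))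
  have hDcont : ContinuousOn (fderiv ℝ h) (closedBall 0 1) :=
    (hcd.continuousOn_fderiv_of_isOpen hU le_rfl).mono hBU
  obtain ⟨K₀, hK₀⟩ := (isCompact_closedBall (0 : E) 1).exists_bound_of_continuousOn hDcont
  let K : ℝ≥0 := K₀.toNNReal + 1
  have hK : ∀ x ∈ closedBall (0 : E) 1, ‖fderiv ℝ h x‖ ≤ K := fun x hx =>
    (hK₀ x hx).trans ((Real.le_coe_toNNReal K₀).trans (by simp [K]))
  have hK1 : (1 : ℝ) ≤ K := by simp [K]
  have hlip : LipschitzOnWith K h (closedBall 0 1) :=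
    (convex_closedBall (0 : E) 1).lipschitzOnWith_of_nnnorm_fderiv_le hdiff hK
  have hint : ∀ t : ℝ, IntegrableOn
      (fun x => (ContinuousLinearMap.id ℝ E + t • fderiv ℝ h x).det) (ball 0 1) := fun t =>
    (ContinuousOn.integrableOn_compact (isCompact_closedBall (0 : E) 1)
      (ContinuousLinearMap.continuous_det.comp_continuousOn
        (continuousOn_const.add (hDcont.const_smul t)))).mono_set ball_subset_closedBall
  have hvol : ∀ t : ℝ, 0 < t → t * K < 1 →
      ∫ x in ball (0 : E) 1, (ContinuousLinearMap.id ℝ E + t • fderiv ℝ h x).det =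
        volume.real (ball (0 : E) 1) := by
    intro t ht htK
    have ht1 : t < 1 := by nlinarith
    have hlt : LipschitzOnWith (t.toNNReal * K) (fun x => t • h x) (closedBall 0 1) := by
      refine LipschitzOnWith.of_dist_le_mul fun x hx y hy => ?_
      rw [dist_smul₀, Real.norm_of_nonneg ht.le, NNReal.coe_mul, Real.coe_toNNReal _ ht.le, mul_assoc]
      exact mul_le_mul_of_nonneg_left (hlip.dist_le_mul x hx y hy) ht.le
    have hlt1 : t.toNNReal * K < 1 := by
      rw [← NNReal.coe_lt_coe, NNReal.coe_mul, Real.coe_toNNReal _ ht.le]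
      exact htK
    have hmaps : MapsTo (fun x => x + t • h x) (ball (0 : E) 1) (ball 0 1) := by
      intro x hx
      have hx' : ‖x‖ < 1 := by simpa using hx
      have hrx := hnorm x (ball_subset_closedBall hx)
      rw [mem_ball_zero_iff]
      calc ‖x + t • h x‖ = ‖(1 - t) • x + t • r x‖ := by
            simp only [hh]
            congr 1
            module
        _ ≤ ‖(1 - t) • x‖ + ‖t • r x‖ := norm_add_le _ _
        _ = (1 - t) * ‖x‖ + t := by
            rw [norm_smul, norm_smul, hrx, Real.norm_of_nonneg ht.le,
              Real.norm_of_nonneg (by linarith), mul_one]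
        _ < 1 := by nlinarith
    obtain ⟨hinj, himg⟩ := image_ball_id_add_eq_ball hlt hlt1
      (fun x hx => by simp [hh, hfix x hx]) hmaps
    have hderiv : ∀ x ∈ ball (0 : E) 1, HasFDerivWithinAt (fun x => x + t • h x)
        (ContinuousLinearMap.id ℝ E + t • fderiv ℝ h x) (ball 0 1) x := fun x hx =>
      ((hasFDerivAt_id x).add
        ((hdiff x (ball_subset_closedBall hx)).hasFDerivAt.const_smul t)).hasFDerivWithinAt
    have key := integral_image_eq_integral_abs_det_fderiv_smul volume measurableSet_ball hderiv
      hinj (fun _ => (1 : ℝ))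
    rw [himg] at key
    simp only [smul_eq_mul, mul_one, integral_const, MeasurableSet.univ,
      measureReal_restrict_apply, univ_inter] at key
    rw [key]
    refine setIntegral_congr_fun measurableSet_ball fun x hx => ?_
    refine (abs_of_pos (det_id_add_smul_pos _ ht.le ?_)).symm
    exact (mul_le_mul_of_nonneg_left (hK x (ball_subset_closedBall hx)) ht.le).trans_lt htK
  have hsing : ∀ x ∈ ball (0 : E) 1,
      (ContinuousLinearMap.id ℝ E + (1 : ℝ) • fderiv ℝ h x).det = 0 := by
    intro x hx
    by_contra hdet
    have hxB := ball_subset_closedBall hx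
    have hrd : HasFDerivAt r (ContinuousLinearMap.id ℝ E + (1 : ℝ) • fderiv ℝ h x) x := by
      have := (hasFDerivAt_id x).add ((hdiff x hxB).hasFDerivAt.const_smul (1 : ℝ))
      refine this.congr_of_eventuallyEq (Filter.Eventually.of_forall fun y => ?_)
      simp [hh]
    have hconst : (fun y => ‖r y‖ ^ 2) =ᶠ[𝓝 x] fun _ => (1 : ℝ) := by
      filter_upwards [isOpen_ball.mem_nhds hx] with y hy
      rw [hnorm y (ball_subset_closedBall hy), one_pow]
    have hzero := (hrd.norm_sq.congr_of_eventuallyEq hconst.symm).unique (hasFDerivAt_const 1 x)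
    obtain ⟨v, hv⟩ := (LinearMap.equivOfDetNeZero _ hdet).surjective (r x)
    have hv' : (ContinuousLinearMap.id ℝ E + (1 : ℝ) • fderiv ℝ h x) v = r x := hv
    have := DFunLike.congr_fun hzero v
    have h2 : (2 : ℝ) * inner ℝ (r x) (r x) = 0 := by
      conv_lhs => enter [2, 3]; rw [← hv']
      simpa [inner_add_right, mul_add] using this
    rw [real_inner_self_eq_norm_sq, hnorm x hxB] at h2
    norm_num at h2
  -- interpolate the volume polynomial from nodes close to `0`, and evaluate it at `1`
  let d := Module.finrank ℝ E
  let ν : ℕ → ℝ := fun i => 1 / ((K : ℝ) * (i + 2))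
  have hνinj : InjOn ν (Finset.range (d + 1)) := by
    intro i _ j _ hij
    have : (K : ℝ) * (i + 2) = K * (j + 2) := by simpa [ν] using hij
    have := mul_left_cancel₀ (by positivity) this
    exact_mod_cast add_right_cancel this
  have hν : ∀ i, 0 < ν i ∧ ν i * K < 1 := fun i => by
    have hi : (0 : ℝ) ≤ i := Nat.cast_nonneg i
    have hKp : (0 : ℝ) < K := by linarith
    refine ⟨by positivity, ?_⟩
    have : ν i * K = 1 / (i + 2) := by simp only [ν]; field_simp
    rw [this, div_lt_one (by positivity)]
    linarith
  let c : ℕ → ℝ := fun i => (Lagrange.basis (Finset.range (d + 1)) ν i).eval 1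
  have hlag : ∀ q : ℝ[X], q.natDegree ≤ d →
      q.eval 1 = ∑ i ∈ Finset.range (d + 1), c i * q.eval (ν i) := by
    intro q hq
    have hdeg : q.degree < (Finset.range (d + 1)).card := by
      rw [Finset.card_range]
      exact (Polynomial.degree_le_natDegree).trans_lt (by exact_mod_cast Nat.lt_succ_of_le hq)
    conv_lhs => rw [Lagrange.eq_interpolate hνinj hdeg]
    simp [Lagrange.interpolate_apply, Polynomial.eval_finsetSum, c, mul_comm]
  have hone : ∑ i ∈ Finset.range (d + 1), c i = 1 := by
    have := hlag 1 (by simp)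
    simpa using this.symm
  have hfinal : ∫ x in ball (0 : E) 1,
      (ContinuousLinearMap.id ℝ E + (1 : ℝ) • fderiv ℝ h x).det =
        volume.real (ball (0 : E) 1) := by
    calc _ = ∫ x in ball (0 : E) 1, ∑ i ∈ Finset.range (d + 1),
          c i * (ContinuousLinearMap.id ℝ E + ν i • fderiv ℝ h x).det := by
          refine integral_congr_ae (Filter.Eventually.of_forall fun x => ?_)
          obtain ⟨q, hq, hqe⟩ := exists_polynomial_eval_eq_det_id_add_smul (fderiv ℝ h x)
          simpa only [hqe] using hlag q hq
      _ = ∑ i ∈ Finset.range (d + 1), c i * volume.real (ball (0 : E) 1) := by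
          rw [integral_finsetSum _ fun i _ => (hint (ν i)).const_mul (c i)]
          refine Finset.sum_congr rfl fun i _ => ?_
          rw [integral_const_mul, hvol _ (hν i).1 (hν i).2]
      _ = _ := by rw [← Finset.sum_mul, hone, one_mul]
  rw [setIntegral_congr_fun measurableSet_ball hsing] at hfinal
  simp only [integral_zero] at hfinal
  have hpos : 0 < volume.real (ball (0 : E) 1) :=
    ENNReal.toReal_pos (measure_ball_pos volume _ one_pos).ne' measure_ball_lt_top.ne
  exact hpos.ne hfinal

/-- A `C¹` self-map of the unit ball with values in the open ball has a fixed point. -/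
theorem exists_fixedPoint_of_contDiff {p : E → E} (hp : ContDiff ℝ 1 p) (hp1 : ∀ x, ‖p x‖ < 1) :
    ∃ x ∈ closedBall (0 : E) 1, p x = x := by
  borelize E
  by_contra! hne
  set u : E → E := fun x => x - p x with hu
  set D : E → ℝ := fun x => (inner ℝ x (u x)) ^ 2 + ‖u x‖ ^ 2 * (1 - ‖x‖ ^ 2) with hD
  set τ : E → ℝ := fun x => (-inner ℝ x (u x) + √(D x)) / ‖u x‖ ^ 2 with hτ
  have hucd : ContDiff ℝ 1 u := contDiff_id.sub hp
  have hbcd : ContDiff ℝ 1 fun x => inner ℝ x (u x) := contDiff_id.inner ℝ hucd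
  have hacd : ContDiff ℝ 1 fun x => ‖u x‖ ^ 2 := hucd.norm_sq ℝ
  have hDcd : ContDiff ℝ 1 D :=
    (hbcd.pow 2).add (hacd.mul (contDiff_const.sub (contDiff_id.norm_sq ℝ)))
  have hU : IsOpen {x | u x ≠ 0 ∧ 0 < D x} :=
    (isOpen_ne_fun hucd.continuous continuous_const).inter
      (isOpen_lt continuous_const hDcd.continuous)
  have hu0 : ∀ x ∈ closedBall (0 : E) 1, u x ≠ 0 := fun x hx h0 =>
    hne x hx (sub_eq_zero.1 h0).symm
  have hb : ∀ x ∈ sphere (0 : E) 1, 0 < inner ℝ x (u x) := by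
    intro x hx
    have hx1 : ‖x‖ = 1 := by simpa using hx
    have h1 : inner ℝ x (p x) ≤ ‖x‖ * ‖p x‖ := real_inner_le_norm x (p x)
    rw [hx1, one_mul] at h1
    simp only [hu, inner_sub_right, real_inner_self_eq_norm_sq, hx1]
    linarith [hp1 x]
  have hDpos : ∀ x ∈ closedBall (0 : E) 1, 0 < D x := by
    intro x hx
    rcases (mem_closedBall.1 hx).lt_or_eq with hlt | heq
    · have hx1 : ‖x‖ < 1 := by simpa using hlt
      have h1 : 0 < 1 - ‖x‖ ^ 2 := by nlinarith [norm_nonneg x]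
      have h2 : 0 < ‖u x‖ := norm_pos_iff.2 (hu0 x hx)
      exact add_pos_of_nonneg_of_pos (sq_nonneg _) (by positivity)
    · have hx1 : ‖x‖ = 1 := by simpa using heq
      have := hb x heq
      simp only [hD, hx1]
      nlinarith
  refine not_exists_contDiffOn_retraction (r := fun x => x + τ x • u x) hU
    (fun x hx => ⟨hu0 x hx, hDpos x hx⟩) ?_ ?_ ?_
  · refine contDiffOn_id.add (ContDiffOn.smul (ContDiffOn.div ?_ hacd.contDiffOn ?_)
      hucd.contDiffOn)
    · exact hbcd.neg.contDiffOn.add (hDcd.contDiffOn.sqrt fun x hx => hx.2.ne')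
    · exact fun x hx => pow_ne_zero 2 (norm_ne_zero_iff.2 hx.1)
  · intro x hx
    have ha : ‖u x‖ ≠ 0 := norm_ne_zero_iff.2 (hu0 x hx)
    have hs : √(D x) ^ 2 = D x := Real.sq_sqrt (hDpos x hx).le
    have hsq : ‖x + τ x • u x‖ ^ 2 = 1 := by
      rw [norm_add_sq_real, inner_smul_right, norm_smul, mul_pow, Real.norm_eq_abs, sq_abs]
      simp only [hτ]
      field_simp
      simp only [hD] at hs ⊢
      linear_combination hs
    exact (sq_eq_sq₀ (norm_nonneg _) zero_le_one).1 (by rw [hsq, one_pow])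
  · intro x hx
    have hx1 : ‖x‖ = 1 := by simpa using hx
    have : τ x = 0 := by
      simp only [hτ, hD, hx1]
      simp [Real.sqrt_sq (hb x hx).le]
    simp [this]

/-- **Brouwer's fixed point theorem**, for a continuous map of bounded range. -/
theorem exists_fixedPoint_of_continuous_of_bounded {f : E → E} (hf : Continuous f) {R : ℝ}
    (hR : ∀ x, ‖f x‖ ≤ R) : ∃ x, f x = x := by
  have hR0 : 0 ≤ R := (norm_nonneg _).trans (hR 0)
  set M : ℝ := 2 * R + 1 with hM
  have hM0 : 0 < M := by linarith
  set g : E → E := fun x => M⁻¹ • f (M • x) with hg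
  have hgc : Continuous g := by fun_prop
  have hg2 : ∀ x, ‖g x‖ ≤ 1 / 2 := by
    intro x
    simp only [hg]
    rw [norm_smul, Real.norm_of_nonneg (by positivity), inv_mul_le_iff₀ hM0]
    linarith [hR (M • x)]
  suffices ∃ x, g x = x by
    obtain ⟨x, hx⟩ := this
    refine ⟨M • x, ?_⟩
    conv_rhs => rw [← hx]
    simp [hg, smul_smul, hM0.ne']
  by_contra! hne
  obtain ⟨x₀, -, hx₀⟩ := (isCompact_closedBall (0 : E) 1).exists_isMinOn
    ⟨0, mem_closedBall_self zero_le_one⟩ (f := fun x => ‖g x - x‖) (by fun_prop)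
  set ε := min (1 / 2) ‖g x₀ - x₀‖ with hε
  have hε0 : 0 < ε := lt_min (by norm_num) (norm_pos_iff.2 (sub_ne_zero.2 (hne x₀)))
  obtain ⟨p, hp, hpg, -⟩ := hgc.exists_contDiff_approx 1 (ε := fun _ => ε) continuous_const
    fun _ => hε0
  obtain ⟨x, hx, hpx⟩ := exists_fixedPoint_of_contDiff hp fun x => by
    have h1 : ‖p x‖ ≤ ‖p x - g x‖ + ‖g x‖ := norm_le_norm_sub_add _ _
    have h2 := hpg x
    rw [dist_eq_norm] at h2
    linarith [hg2 x, min_le_left (1 / 2) ‖g x₀ - x₀‖]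
  have h1 := hpg x
  rw [hpx, dist_comm, dist_eq_norm] at h1
  exact absurd (hx₀ hx) (not_le.2 (h1.trans_le (min_le_right _ _)))

end Brouwer

section SimplexRetraction

variable {α : Type*} [Fintype α]

/-- A retraction of `α → ℝ` onto the standard simplex. -/
noncomputable def simplexRetract (y : α → ℝ) (a : α) : ℝ :=
  (max (y a) 0 + max 0 (1 - ∑ b, max (y b) 0) / Fintype.card α) / max 1 (∑ b, max (y b) 0)

theorem isDist_simplexRetract [Nonempty α] (y : α → ℝ) : IsDist (simplexRetract y) := by
  refine ⟨fun a => by unfold simplexRetract; positivity, ?_⟩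
  have hc : (Fintype.card α : ℝ) ≠ 0 := Nat.cast_ne_zero.2 Fintype.card_ne_zero
  simp only [simplexRetract, ← sum_div, sum_add_distrib, sum_const, card_univ, nsmul_eq_mul]
  rw [mul_div_cancel_left₀ _ hc]
  rcases le_total 1 (∑ b, max (y b) 0) with h | h
  · rw [max_eq_left (by linarith), max_eq_right h, add_zero, div_self (by linarith)]
  · rw [max_eq_right (by linarith), max_eq_left h]
    ring

theorem simplexRetract_eq_self {y : α → ℝ} (hy : IsDist y) : simplexRetract y = y := by
  have h : ∀ a, max (y a) 0 = y a := fun a => max_eq_left (hy.1 a)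
  ext a
  simp [simplexRetract, h, hy.2]

theorem continuous_simplexRetract (a : α) : Continuous fun y : α → ℝ => simplexRetract y a := by
  unfold simplexRetract
  refine Continuous.div (by fun_prop) (by fun_prop) fun y => ?_
  exact (zero_lt_one.trans_le (le_max_left _ _)).ne'

end SimplexRetraction

section DiscountedGame

variable {n : ℕ} {S : Type*} {A : Fin n → Type*} [∀ k, Fintype (A k)]

theorem IsDist.sum_mul_le {α : Type*} [Fintype α] {f : α → ℝ} (hf : IsDist f) {g : α → ℝ} {c : ℝ}
    (hg : ∀ x, g x ≤ c) : ∑ x, f x * g x ≤ c :=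
  calc ∑ x, f x * g x ≤ ∑ x, f x * c := sum_le_sum fun x _ => mul_le_mul_of_nonneg_left (hg x) (hf.1 x)
    _ = c := by rw [← sum_mul, hf.2, one_mul]

theorem IsDist.abs_sum_mul_le {α : Type*} [Fintype α] {f : α → ℝ} (hf : IsDist f) {g : α → ℝ}
    {c : ℝ} (hg : ∀ x, |g x| ≤ c) : |∑ x, f x * g x| ≤ c := by
  refine abs_le.2 ⟨?_, hf.sum_mul_le fun x => (abs_le.1 (hg x)).2⟩
  have := hf.sum_mul_le (g := fun x => -g x) fun x => neg_le.1 (abs_le.1 (hg x)).1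
  simp only [mul_neg, sum_neg_distrib] at this
  linarith

theorem IsDist.bind {α β : Type*} [Fintype α] [Fintype β] {f : α → ℝ} (hf : IsDist f)
    {κ : α → β → ℝ} (hκ : ∀ x, IsDist (κ x)) : IsDist fun y => ∑ x, f x * κ x y := by
  refine ⟨fun y => sum_nonneg fun x _ => mul_nonneg (hf.1 x) ((hκ x).1 y), ?_⟩
  rw [sum_comm]
  simp_rw [← mul_sum, (hκ _).2, mul_one, hf.2]

section Value

variable [Fintype S] [DecidableEq S] {γ : ℝ} {P : S → (∀ k, A k) → S → ℝ}
  {rk : S → (∀ k, A k) → ℝ} {σ : S → (∀ k, A k) → ℝ}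

theorem isDist_matPow (hP : IsKer P) (hσ : ∀ s, IsDist (σ s)) (h : ℕ) (s : S) :
    IsDist (matPow P σ h s) := by
  induction h with
  | zero => exact ⟨fun x => by simp only [matPow]; split_ifs <;> norm_num, by simp [matPow]⟩
  | succ h ih => exact ih.bind fun t => (hσ t).bind (hP t)

theorem matPow_eq_pow (h : ℕ) (s s' : S) :
    matPow P σ h s s' = ((Matrix.of fun s s' => ∑ a, σ s a * P s a s') ^ h) s s' := by
  induction h generalizing s' with
  | zero => simp [matPow, Matrix.one_apply]
  | succ h ih => simp [matPow, pow_succ, Matrix.mul_apply, ih]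

theorem matPow_succ_left (h : ℕ) (s s' : S) :
    matPow P σ (h + 1) s s' = ∑ t, (∑ a, σ s a * P s a t) * matPow P σ h t s' := by
  simp [matPow_eq_pow, pow_succ', Matrix.mul_apply]

theorem abs_vinf_term_le (hγ : 0 ≤ γ) (hP : IsKer P) (hσ : ∀ s, IsDist (σ s))
    (hr : ∀ s a, |rk s a| ≤ 1) (h : ℕ) (s : S) :
    |γ ^ h * ∑ s', matPow P σ h s s' * expRew σ rk s'| ≤ γ ^ h := by
  rw [abs_mul, abs_of_nonneg (pow_nonneg hγ h)]
  exact mul_le_of_le_one_right (pow_nonneg hγ h)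
    ((isDist_matPow hP hσ h s).abs_sum_mul_le fun s' => (hσ s').abs_sum_mul_le (hr s'))

theorem summable_vinf (hγ : γ ∈ Set.Ioo (0 : ℝ) 1) (hP : IsKer P) (hσ : ∀ s, IsDist (σ s))
    (hr : ∀ s a, |rk s a| ≤ 1) (s : S) :
    Summable fun h : ℕ => γ ^ h * ∑ s', matPow P σ h s s' * expRew σ rk s' :=
  Summable.of_norm_bounded (summable_geometric_of_lt_one hγ.1.le hγ.2) fun h =>
    abs_vinf_term_le hγ.1.le hP hσ hr h s

/-- The Bellman equation for the value of a stationary policy. -/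
theorem vinf_eq_bellman (hγ : γ ∈ Set.Ioo (0 : ℝ) 1) (hP : IsKer P) (hσ : ∀ s, IsDist (σ s))
    (hr : ∀ s a, |rk s a| ≤ 1) (s : S) :
    vinf γ P rk σ s = ∑ a, σ s a * (rk s a + γ * ∑ s', P s a s' * vinf γ P rk σ s') := by
  have hsum := summable_vinf hγ hP hσ hr
  have hstep : ∀ h : ℕ, γ ^ (h + 1) * ∑ s', matPow P σ (h + 1) s s' * expRew σ rk s' =
      ∑ t, γ * (∑ a, σ s a * P s a t) * (γ ^ h * ∑ s', matPow P σ h t s' * expRew σ rk s') := by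
    intro h
    have hsplit : ∀ s', matPow P σ (h + 1) s s' * expRew σ rk s' =
        ∑ t, (∑ a, σ s a * P s a t) * (matPow P σ h t s' * expRew σ rk s') := fun s' => by
      rw [matPow_succ_left, sum_mul]
      exact sum_congr rfl fun t _ => mul_assoc _ _ _
    simp_rw [hsplit]
    rw [sum_comm, mul_sum]
    refine sum_congr rfl fun t _ => ?_
    rw [← mul_sum]
    ring
  have h0 : ∑ s', matPow P σ 0 s s' * expRew σ rk s' = expRew σ rk s := by simp [matPow]
  rw [vinf, (hsum s).tsum_eq_zero_add]
  simp_rw [hstep]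
  rw [Summable.tsum_finsetSum fun t _ => (hsum t).mul_left _]
  simp_rw [tsum_mul_left, h0, pow_zero, one_mul, ← vinf.eq_1]
  simp_rw [mul_add, sum_add_distrib, expRew]
  congr 1
  simp_rw [mul_sum, sum_mul]
  rw [sum_comm]
  refine sum_congr rfl fun a _ => sum_congr rfl fun t _ => ?_
  ring

/-- A function dominating its one-step backup under `σ` dominates the value of `σ`. -/
theorem vinf_le_of_backup_le (hγ : γ ∈ Set.Ioo (0 : ℝ) 1) (hP : IsKer P) (hσ : ∀ s, IsDist (σ s))
    (hr : ∀ s a, |rk s a| ≤ 1) {w : S → ℝ}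
    (hw : ∀ s, ∑ a, σ s a * (rk s a + γ * ∑ s', P s a s' * w s') ≤ w s) (s : S) :
    vinf γ P rk σ s ≤ w s := by
  set V := vinf γ P rk σ with hV
  obtain ⟨m, -, hm⟩ := exists_max_image univ (fun s => V s - w s) ⟨s, mem_univ s⟩
  have hbell : V m = ∑ a, σ m a * (rk m a + γ * ∑ s', P m a s' * V s') :=
    vinf_eq_bellman hγ hP hσ hr m
  have h1 : ∑ a, σ m a * (γ * ∑ s', P m a s' * (V s' - w s')) ≤ γ * (V m - w m) :=
    (hσ m).sum_mul_le fun a => mul_le_mul_of_nonneg_left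
      ((hP m a).sum_mul_le fun s' => hm s' (mem_univ s')) hγ.1.le
  have h2 : ∑ a, σ m a * (γ * ∑ s', P m a s' * (V s' - w s')) =
      ∑ a, σ m a * (rk m a + γ * ∑ s', P m a s' * V s') -
        ∑ a, σ m a * (rk m a + γ * ∑ s', P m a s' * w s') := by
    rw [← sum_sub_distrib]
    refine sum_congr rfl fun a _ => ?_
    simp_rw [mul_sub, sum_sub_distrib]
    ring
  have h3 := hw m
  have h4 : V m - w m ≤ 0 := by nlinarith [hγ.2]
  linarith [hm s (mem_univ s)]

theorem continuous_vinf {X : Type*} [TopologicalSpace X] (hγ : γ ∈ Set.Ioo (0 : ℝ) 1)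
    (hP : IsKer P) (hr : ∀ s a, |rk s a| ≤ 1) {σ : X → S → (∀ k, A k) → ℝ}
    (hσ : ∀ x s, IsDist (σ x s)) (hc : ∀ s a, Continuous fun x => σ x s a) (s : S) :
    Continuous fun x => vinf γ P rk (σ x) s := by
  have hpow : ∀ h s s', Continuous fun x => matPow P (σ x) h s s' := by
    intro h
    induction h with
    | zero => exact fun s s' => continuous_const
    | succ h ih =>
      exact fun s s' => continuous_finsetSum _ fun t _ =>
        (ih s t).mul (continuous_finsetSum _ fun a _ => (hc t a).mul continuous_const)
  refine continuous_tsum (fun h => ?_) (summable_geometric_of_lt_one hγ.1.le hγ.2)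
    fun h x => abs_vinf_term_le hγ.1.le hP (hσ x) hr h s
  exact continuous_const.mul (continuous_finsetSum _ fun s' _ => (hpow h s s').mul
    (continuous_finsetSum _ fun a _ => (hc s' a).mul continuous_const))

/-- In a zero-sum game the values of all players add up to zero. -/
theorem sum_vinf_eq_zero {r : Fin n → S → (∀ k, A k) → ℝ} (hγ : γ ∈ Set.Ioo (0 : ℝ) 1)
    (hP : IsKer P) (hr : ∀ k s a, |r k s a| ≤ 1) (hσ : ∀ s, IsDist (σ s))
    (hzs : ∀ s a, ∑ k, r k s a = 0) (s : S) : ∑ k, vinf γ P (r k) σ s = 0 := by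
  simp only [vinf]
  rw [← Summable.tsum_finsetSum fun k _ => summable_vinf hγ hP hσ (hr k) s]
  refine (tsum_congr fun h => ?_).trans tsum_zero
  rw [← mul_sum, sum_comm]
  simp_rw [expRew, ← mul_sum]
  refine mul_eq_zero_of_right _ (sum_eq_zero fun s' _ => mul_eq_zero_of_right _ ?_)
  rw [sum_comm]
  simp [← mul_sum, hzs]

end Value

section ProductPolicy

variable {π : ∀ k, S → A k → ℝ}

theorem isDist_prodPolI (hπ : ∀ k, IsStatPol (π k)) (s : S) : IsDist (prodPolI π s) := by
  classical
  refine ⟨fun a => prod_nonneg fun k _ => (hπ k s).1 _, ?_⟩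
  simp only [prodPolI]
  rw [← Fintype.prod_sum]
  exact prod_eq_one fun k _ => (hπ k s).2

theorem deviateI_prodPolI_apply (hπ : ∀ k, IsStatPol (π k)) (k : Fin n) (π' : S → A k → ℝ) (s : S)
    (a : ∀ j, A j) : deviateI k π' (prodPolI π) s a =
      π' s (a k) * ∏ j ∈ univ.filter (fun j => j ≠ k), π j s (a j) := by
  have h : ∀ b : A k, prodPolI π s (Function.update a k b) =
      π k s b * ∏ j ∈ univ.filter (fun j => j ≠ k), π j s (a j) := by
    intro b
    rw [prodPolI, ← mul_prod_erase univ _ (mem_univ k), Function.update_self, filter_ne']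
    congr 1
    refine prod_congr rfl fun j hj => ?_
    rw [Function.update_of_ne (ne_of_mem_erase hj)]
  simp_rw [deviateI, h, ← sum_mul, (hπ k s).2, one_mul]

theorem deviateI_prodPolI_self (hπ : ∀ k, IsStatPol (π k)) (k : Fin n) :
    deviateI k (π k) (prodPolI π) = prodPolI π := by
  ext s a
  rw [deviateI_prodPolI_apply hπ, prodPolI, ← mul_prod_erase univ _ (mem_univ k), filter_ne']

theorem isDist_deviateI_prodPolI (hπ : ∀ k, IsStatPol (π k)) {k : Fin n} {π' : S → A k → ℝ}
    (hπ' : IsStatPol π') (s : S) : IsDist (deviateI k π' (prodPolI π) s) := by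
  have h : deviateI k π' (prodPolI π) s = prodPolI (Function.update π k π') s := by
    ext a
    rw [deviateI_prodPolI_apply hπ, prodPolI, ← mul_prod_erase univ _ (mem_univ k),
      Function.update_self, filter_ne']
    congr 1
    refine prod_congr rfl fun j hj => ?_
    rw [Function.update_of_ne (ne_of_mem_erase hj)]
  rw [h]
  refine isDist_prodPolI (fun j => ?_) s
  rcases eq_or_ne j k with rfl | hj
  · simpa using hπ'
  · simpa [Function.update_of_ne hj] using hπ j

variable [Fintype S] [∀ k, DecidableEq (A k)]

/-- The value to player `k` of playing `b` at state `s` against `π`, with continuation `w`. -/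
noncomputable def actionValue (γ : ℝ) (P : S → (∀ k, A k) → S → ℝ)
    (rk : S → (∀ k, A k) → ℝ) (π : ∀ k, S → A k → ℝ) (k : Fin n) (w : S → ℝ) (s : S)
    (b : A k) : ℝ :=
  ∑ a : ∀ j, A j, if a k = b then
    (∏ j ∈ univ.filter (fun j => j ≠ k), π j s (a j)) * (rk s a + γ * ∑ s', P s a s' * w s')
  else 0

theorem sum_mul_actionValue (hπ : ∀ k, IsStatPol (π k)) (γ : ℝ) (P : S → (∀ k, A k) → S → ℝ)
    (rk : S → (∀ k, A k) → ℝ) (k : Fin n) (π' : S → A k → ℝ) (w : S → ℝ) (s : S) :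
    ∑ b, π' s b * actionValue γ P rk π k w s b =
      ∑ a, deviateI k π' (prodPolI π) s a * (rk s a + γ * ∑ s', P s a s' * w s') := by
  have hpush : ∀ b, π' s b * actionValue γ P rk π k w s b = ∑ a : ∀ j, A j, if a k = b then
      π' s b * ((∏ j ∈ univ.filter (fun j => j ≠ k), π j s (a j)) *
        (rk s a + γ * ∑ s', P s a s' * w s')) else 0 := fun b => by
    rw [actionValue, mul_sum]
    simp only [mul_ite, mul_zero]
  simp_rw [hpush]
  rw [sum_comm]
  refine sum_congr rfl fun a _ => ?_
  simp [deviateI_prodPolI_apply hπ, mul_assoc]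

variable [DecidableEq S] {γ : ℝ} {P : S → (∀ k, A k) → S → ℝ} {rk : S → (∀ k, A k) → ℝ}

/-- If no action improves on `w`, then no deviation of player `k` from `π` is worth more. -/
theorem vinf_deviateI_le_of_actionValue_le (hγ : γ ∈ Set.Ioo (0 : ℝ) 1) (hP : IsKer P)
    (hr : ∀ s a, |rk s a| ≤ 1) (hπ : ∀ k, IsStatPol (π k)) {k : Fin n} {w : S → ℝ}
    (hw : ∀ s b, actionValue γ P rk π k w s b ≤ w s) {π' : S → A k → ℝ} (hπ' : IsStatPol π')
    (s : S) : vinf γ P rk (deviateI k π' (prodPolI π)) s ≤ w s := by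
  refine vinf_le_of_backup_le hγ hP (isDist_deviateI_prodPolI hπ hπ') hr (fun s => ?_) s
  rw [← sum_mul_actionValue hπ]
  exact (hπ' s).sum_mul_le (hw s)

end ProductPolicy

/-- If `p` is invariant under the Nash improvement step for payoffs `Q`, then no action has a
payoff above the `p`-average. -/
theorem IsDist.le_of_nash_step_eq {α : Type*} [Fintype α] {p Q : α → ℝ} {v : ℝ} (hp : IsDist p)
    (hv : ∑ b, p b * Q b = v)
    (hfix : ∀ b, (p b + max 0 (Q b - v)) / (1 + ∑ c, max 0 (Q c - v)) = p b) (b : α) :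
    Q b ≤ v := by
  set G := ∑ c, max 0 (Q c - v) with hG
  have hG0 : 0 ≤ G := sum_nonneg fun c _ => le_max_left _ _
  have hgain : ∀ c, max 0 (Q c - v) = p c * G := fun c => by
    have := hfix c
    rw [div_eq_iff (by positivity)] at this
    linarith
  have hsum : ∑ c, p c * (Q c - v) = 0 := by
    simp_rw [mul_sub, sum_sub_distrib, ← sum_mul, hp.2, hv, one_mul, sub_self]
  have hsq : ∑ c, p c * G * (Q c - v) = 0 := by
    simp_rw [mul_right_comm _ G, ← sum_mul, hsum, zero_mul]
  have hnonneg : ∀ c ∈ univ, 0 ≤ p c * G * (Q c - v) := fun c _ => by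
    rw [← hgain c]
    rcases le_total 0 (Q c - v) with h | h
    · exact mul_nonneg (le_max_left _ _) h
    · simp [max_eq_left h]
  have hb := (sum_eq_zero_iff_of_nonneg hnonneg).1 hsq b (mem_univ b)
  rw [← hgain b] at hb
  by_contra! hlt
  have hpos : 0 < Q b - v := sub_pos.2 hlt
  rw [max_eq_right hpos.le] at hb
  exact (mul_pos hpos hpos).ne' hb

variable [Fintype S] [DecidableEq S] [∀ k, DecidableEq (A k)] [∀ k, Nonempty (A k)]

/-- Existence of a stationary Markov perfect equilibrium in product policies. -/
theorem exists_statPol_actionValue_le {γ : ℝ} {P : S → (∀ k, A k) → S → ℝ}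
    {r : Fin n → S → (∀ k, A k) → ℝ} (hγ : γ ∈ Set.Ioo (0 : ℝ) 1) (hP : IsKer P)
    (hr : ∀ k s a, |r k s a| ≤ 1) :
    ∃ π : ∀ k, S → A k → ℝ, (∀ k, IsStatPol (π k)) ∧ ∀ k s b,
      actionValue γ P (r k) π k (vinf γ P (r k) (prodPolI π)) s b ≤
        vinf γ P (r k) (prodPolI π) s := by
  let I := Σ k : Fin n, S × A k
  let pol : EuclideanSpace ℝ I → ∀ k, S → A k → ℝ := fun y k s =>
    simplexRetract fun b => y ⟨k, s, b⟩
  let V : EuclideanSpace ℝ I → ∀ _ : Fin n, S → ℝ := fun y k => vinf γ P (r k) (prodPolI (pol y))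
  let gain : EuclideanSpace ℝ I → ∀ k, S → A k → ℝ := fun y k s b =>
    max 0 (actionValue γ P (r k) (pol y) k (V y k) s b - V y k s)
  let N : EuclideanSpace ℝ I → EuclideanSpace ℝ I := fun y => WithLp.toLp 2 fun i =>
    (pol y i.1 i.2.1 i.2.2 + gain y i.1 i.2.1 i.2.2) / (1 + ∑ c, gain y i.1 i.2.1 c)
  have hpol : ∀ y k, IsStatPol (pol y k) := fun y k s => isDist_simplexRetract _
  have hpolc : ∀ k s b, Continuous fun y => pol y k s b := fun k s b =>
    (continuous_simplexRetract b).comp (f := fun (y : EuclideanSpace ℝ I) c => y ⟨k, s, c⟩)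
      (by fun_prop)
  have hVc : ∀ k s, Continuous fun y => V y k s := fun k s =>
    continuous_vinf hγ hP (hr k) (fun y => isDist_prodPolI (hpol y))
      (fun s a => continuous_finsetProd _ fun j _ => hpolc j s (a j)) s
  have hgainc : ∀ k s b, Continuous fun y => gain y k s b := by
    intro k s b
    refine continuous_const.max (Continuous.sub (continuous_finsetSum _ fun a _ => ?_) (hVc k s))
    by_cases h : a k = b
    · simp only [h, if_true]
      refine (continuous_finsetProd _ fun j _ => hpolc j s (a j)).mul (continuous_const.add
        (continuous_const.mul (continuous_finsetSum _ fun s' _ => continuous_const.mul (hVc k s'))))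
    · simpa only [h, if_false] using continuous_const
  have hgain0 : ∀ y k s b, 0 ≤ gain y k s b := fun y k s b => le_max_left _ _
  have hden : ∀ y k s, 0 < 1 + ∑ c, gain y k s c := fun y k s =>
    add_pos_of_pos_of_nonneg one_pos (sum_nonneg fun c _ => hgain0 y k s c)
  have hNdist : ∀ y k s, IsDist fun b => N y ⟨k, s, b⟩ := by
    intro y k s
    refine ⟨fun b => div_nonneg (add_nonneg ((hpol y k s).1 b) (hgain0 y k s b)) (hden y k s).le, ?_⟩
    have hsum : ∑ b, (pol y k s b + gain y k s b) / (1 + ∑ c, gain y k s c) = 1 := by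
      rw [← sum_div, sum_add_distrib, (hpol y k s).2, div_self (hden y k s).ne']
    exact hsum
  have hNc : Continuous N := by
    refine (PiLp.continuous_toLp 2 _).comp (continuous_pi fun i => ?_)
    exact ((hpolc _ _ _).add (hgainc _ _ _)).div
      (continuous_const.add (continuous_finsetSum _ fun c _ => hgainc _ _ c))
      fun y => (hden y _ _).ne'
  have hNb : ∀ y, ‖N y‖ ≤ √(Fintype.card I) := by
    intro y
    rw [EuclideanSpace.norm_eq]
    refine Real.sqrt_le_sqrt ?_
    have : ∀ i : I, ‖N y i‖ ^ 2 ≤ 1 := fun ⟨k, s, b⟩ => by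
      have h0 := (hNdist y k s).1 b
      have h1 : N y ⟨k, s, b⟩ ≤ 1 := by
        rw [← (hNdist y k s).2]
        exact single_le_sum (f := fun b => N y ⟨k, s, b⟩) (fun c _ => (hNdist y k s).1 c)
          (mem_univ b)
      rw [Real.norm_of_nonneg h0]
      exact pow_le_one₀ h0 h1
    simpa using sum_le_sum fun i (_ : i ∈ univ) => this i
  obtain ⟨y, hy⟩ := exists_fixedPoint_of_continuous_of_bounded hNc hNb
  have hself : ∀ k s b, pol y k s b = y ⟨k, s, b⟩ := fun k s b => by
    have hd := hNdist y k s
    rw [hy] at hd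
    exact congrFun (simplexRetract_eq_self hd) b
  refine ⟨pol y, hpol y, fun k s => (hpol y k s).le_of_nash_step_eq ?_ fun b => ?_⟩
  · rw [sum_mul_actionValue (hpol y), deviateI_prodPolI_self (hpol y)]
    exact (vinf_eq_bellman hγ hP (isDist_prodPolI (hpol y)) (hr k) s).symm
  · have : N y ⟨k, s, b⟩ = pol y k s b := by rw [hy, hself]
    exact this

end DiscountedGame

theorem PNE_feasible_nonneg_min_zero_discounted
    {n : ℕ} {S : Type*} [Fintype S] [DecidableEq S] {A : Fin n → Type*}
    [∀ k, Fintype (A k)] [∀ k, DecidableEq (A k)] [∀ k, Nonempty (A k)]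
    (γ : ℝ) (P : S → (∀ k, A k) → S → ℝ)
    (r : Fin n → S → (∀ k, A k) → ℝ) (ρ : S → ℝ)
    (hγ : γ ∈ Set.Ioo (0 : ℝ) 1) (hP : IsKer P) (hr : IsRew r)
    (hρ : IsDist ρ) (hzs : IsZSPolymatrixI r) :
    (∃ π w, FeasNEI γ P r π w) ∧
    (∀ π w, FeasNEI γ P r π w →
      objNEI γ P r ρ π w = ∑ k, ∑ s, ρ s * w k s ∧
        0 ≤ objNEI γ P r ρ π w) ∧
    (∃ π w, FeasNEI γ P r π w ∧ IsNEI γ P r ρ 0 π ∧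
      (∀ (k : Fin n) (s : S), IsBRValI γ P (r k) (prodPolI π) k s (w k s)) ∧
      objNEI γ P r ρ π w = 0) := by
  have hr' : ∀ k s a, |r k s a| ≤ 1 := fun k s a => abs_le.2 (hr k s a)
  obtain ⟨π, hπ, hopt⟩ := exists_statPol_actionValue_le hγ hP hr'
  have hobj : ∀ (π : ∀ k, S → A k → ℝ) (w : Fin n → S → ℝ), (∀ k, IsStatPol (π k)) →
      objNEI γ P r ρ π w = ∑ k, ∑ s, ρ s * w k s := by
    intro π w hπ
    have h0 : ∑ k, ∑ s, ρ s * vinf γ P (r k) (prodPolI π) s = 0 := by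
      rw [sum_comm]
      simp_rw [← mul_sum, sum_vinf_eq_zero hγ hP hr' (isDist_prodPolI hπ) hzs.1, mul_zero,
        sum_const_zero]
    simp_rw [objNEI, mul_sub, sum_sub_distrib]
    rw [h0, sub_zero]
  let w : Fin n → S → ℝ := fun k => vinf γ P (r k) (prodPolI π)
  have hfeas : FeasNEI γ P r π w := ⟨hπ, hopt⟩
  have hdev : ∀ (k : Fin n) (π' : S → A k → ℝ), IsStatPol π' → ∀ s,
      vinf γ P (r k) (deviateI k π' (prodPolI π)) s ≤ w k s := fun k π' hπ' s =>
    vinf_deviateI_le_of_actionValue_le hγ hP (hr' k) hπ (hopt k) hπ' s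
  refine ⟨⟨π, w, hfeas⟩, fun π w hw => ⟨hobj π w hw.1, ?_⟩, π, w, hfeas, ?_, ?_, ?_⟩
  · refine sum_nonneg fun k _ => sum_nonneg fun s _ => mul_nonneg (hρ.1 s) (sub_nonneg.2 ?_)
    have := vinf_deviateI_le_of_actionValue_le hγ hP (hr' k) hw.1 (hw.2 k) (hw.1 k) s
    rwa [deviateI_prodPolI_self hw.1] at this
  · exact fun k π' hπ' => sub_nonpos.2 <|
      sum_le_sum fun s _ => mul_le_mul_of_nonneg_left (hdev k π' hπ' s) (hρ.1 s)
  · refine fun k s => ⟨⟨π k, hπ k, ?_⟩, ?_⟩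
    · rw [deviateI_prodPolI_self hπ]
    · rintro _ ⟨π', hπ', rfl⟩
      exact hdev k π' hπ' s
  · simp [objNEI, w]
end

section
/- There exists an infinite-horizon discounted zero-sum polymatrix Markov game Γ (which does not satisfy the switching-control assumption: more than one player affects the transitions) together with an exact (0-approximate) stationary CCE σ of Γ such that the marginal product policy π^σ is not a Nash equilibrium of Γ; in fact, π^σ is not an ε-approximate NE for any ε < 2/15. -/
open Finset

/-- An infinite-horizon discounted Markov game (bundled). -/
structure DiscGame where
  /-- number of players -/
  n : ℕ
  /-- state space -/
  S : Type
  fintS : Fintype S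
  decS : DecidableEq S
  /-- action spaces -/
  A : Fin n → Type
  fintA : ∀ k, Fintype (A k)
  decA : ∀ k, DecidableEq (A k)
  /-- transition kernel -/
  P : S → (∀ k, A k) → S → ℝ
  /-- reward functions -/
  r : Fin n → S → (∀ k, A k) → ℝ
  /-- discount factor -/
  γ : ℝ
  /-- initial state distribution -/
  ρ : S → ℝ

attribute [instance] DiscGame.fintS DiscGame.decS DiscGame.fintA DiscGame.decA

namespace CoordinationGame

/-- From the initial state `false`, the absorbing state `true` is reached exactly when player `0`
plays `true` and players `1` and `2` miscoordinate. -/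
noncomputable def kernel (s : Bool) (a : Fin 3 → Bool) (s' : Bool) : ℝ :=
  if s' = (s || (a 0 && (a 1 ^^ a 2))) then 1 else 0

/-- In state `true`, player `1` pays one unit to player `0`. -/
noncomputable def reward (k : Fin 3) (s : Bool) (_ : Fin 3 → Bool) : ℝ :=
  if s then ![1, -1, 0] k else 0

/-- Player `0` plays `false` while players `1` and `2` share a fair coin. -/
noncomputable def corr (_ : Bool) (a : Fin 3 → Bool) : ℝ :=
  if a 0 = false ∧ a 1 = a 2 then 1 / 2 else 0

noncomputable def game : DiscGame where
  n := 3
  S := Bool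
  fintS := inferInstance
  decS := inferInstance
  A := fun _ => Bool
  fintA := fun _ => inferInstance
  decA := fun _ => inferInstance
  P := kernel
  r := reward
  γ := 1 / 2
  ρ := fun s => if s then 0 else 1

theorem sum_fin_three_bool (f : (Fin 3 → Bool) → ℝ) :
    ∑ a, f a = ∑ x, ∑ y, ∑ z, f ![x, y, z] := by
  simp only [← Fintype.sum_prod_type']
  refine Fintype.sum_equiv
    ⟨fun a => (a 0, a 1, a 2), fun p => ![p.1, p.2.1, p.2.2], ?_, ?_⟩ _ _ ?_
  · intro a; ext i; fin_cases i <;> rfl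
  · intro p; rfl
  · intro a; congr 1; ext i; fin_cases i <;> rfl

theorem isDist_kernel (s : Bool) (a : Fin 3 → Bool) : IsDist (kernel s a) := by
  refine ⟨fun s' => ?_, ?_⟩
  · unfold kernel; split_ifs <;> norm_num
  · simp [kernel]

theorem isDist_corr (s : Bool) : IsDist (corr s) := by
  refine ⟨fun a => ?_, ?_⟩
  · unfold corr; split_ifs <;> norm_num
  · rw [sum_fin_three_bool]; simp [corr]; norm_num

theorem isRew_reward : IsRew reward := by
  intro k s a
  fin_cases k <;> cases s <;> simp [reward]

theorem isZSPolymatrixI_reward : IsZSPolymatrixI reward := by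
  refine ⟨fun s a => ?_, fun k j s _ _ =>
    if s then !![0, 1, 0; -1, 0, 0; 0, 0, 0] k j else 0, fun k j s _ _ => ?_, fun k s a => ?_⟩
  · cases s <;> simp [reward, Fin.sum_univ_three]
  · fin_cases k <;> fin_cases j <;> cases s <;> simp
  · rw [Finset.sum_filter]
    fin_cases k <;> cases s <;> simp [reward, Fin.sum_univ_three]

theorem not_switchingControlI_kernel : ¬ SwitchingControlI kernel := by
  intro h
  obtain ⟨k, hk⟩ := h false
  fin_cases k
  · simpa [kernel] using congrFun (hk ![true, true, false] ![true, false, false] rfl) true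
  · simpa [kernel] using congrFun (hk ![true, true, false] ![false, true, false] rfl) true
  · simpa [kernel] using congrFun (hk ![true, true, false] ![false, true, false] rfl) true

theorem expRew_false (τ : Bool → (Fin 3 → Bool) → ℝ) (k : Fin 3) :
    expRew τ (reward k) false = 0 := by
  simp [expRew, reward]

theorem vinf_eq_tsum (τ : Bool → (Fin 3 → Bool) → ℝ) (k : Fin 3) :
    vinf (1 / 2) kernel (reward k) τ false =
      ∑' h : ℕ, (1 / 2) ^ h * (matPow kernel τ h false true * expRew τ (reward k) true) := by
  simp [vinf, expRew_false]

/-- If play never leaves the initial state, its value is zero. -/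
theorem vinf_eq_zero (τ : Bool → (Fin 3 → Bool) → ℝ) (k : Fin 3)
    (h : ∑ a, τ false a * kernel false a true = 0) :
    vinf (1 / 2) kernel (reward k) τ false = 0 := by
  have hm : ∀ n, matPow kernel τ n false true = 0 := by
    intro n
    induction n with
    | zero => simp [matPow]
    | succ n ih => simp [matPow, ih, h]
  rw [vinf_eq_tsum]
  simp [hm]

theorem vinf_corr (k : Fin 3) : vinf (1 / 2) kernel (reward k) corr false = 0 := by
  apply vinf_eq_zero
  rw [sum_fin_three_bool]
  simp [corr, kernel]

theorem vinf_deviateI_corr (k : Fin 3) (π' : Bool → Bool → ℝ) :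
    vinf (1 / 2) kernel (reward k) (deviateI k π' corr) false = 0 := by
  apply vinf_eq_zero
  rw [sum_fin_three_bool]
  fin_cases k <;> simp [deviateI, corr, kernel, Function.update]

/-- The product of the marginals of `corr`. -/
noncomputable def prodMarginal : Bool → (Fin 3 → Bool) → ℝ :=
  prodPolI (A := fun _ : Fin 3 => Bool) (fun k => marginalI corr k)

theorem prodMarginal_apply (s : Bool) (a : Fin 3 → Bool) :
    prodMarginal s a = if a 0 then 0 else 1 / 4 := by
  have h0 : marginalI corr 0 s (a 0) = if a 0 then 0 else 1 := by
    unfold marginalI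
    rw [sum_fin_three_bool]
    cases a 0 <;> simp [corr] <;> norm_num
  have h1 : marginalI corr 1 s (a 1) = 1 / 2 := by
    unfold marginalI
    rw [sum_fin_three_bool]
    cases a 1 <;> simp [corr]
  have h2 : marginalI corr 2 s (a 2) = 1 / 2 := by
    unfold marginalI
    rw [sum_fin_three_bool]
    cases a 2 <;> simp [corr]
  rw [prodMarginal, prodPolI, Fin.prod_univ_three, h0, h1, h2]
  cases a 0 <;> norm_num

theorem vinf_prodMarginal (k : Fin 3) :
    vinf (1 / 2) kernel (reward k) prodMarginal false = 0 := by
  apply vinf_eq_zero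
  rw [sum_fin_three_bool]
  simp [prodMarginal_apply, kernel]

/-- The policy that always plays `true`. -/
noncomputable def alwaysTrue (_ : Bool) (b : Bool) : ℝ := if b then 1 else 0

theorem deviateI_alwaysTrue_prodMarginal (s : Bool) (a : Fin 3 → Bool) :
    deviateI 0 alwaysTrue prodMarginal s a = if a 0 then 1 / 4 else 0 := by
  simp [deviateI, alwaysTrue, prodMarginal_apply]

theorem vinf_deviateI_alwaysTrue :
    vinf (1 / 2) kernel (reward 0) (deviateI 0 alwaysTrue prodMarginal) false = 2 / 3 := by
  have hm : ∀ n, matPow kernel (deviateI 0 alwaysTrue prodMarginal) n false false = (1 / 2) ^ n ∧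
      matPow kernel (deviateI 0 alwaysTrue prodMarginal) n false true = 1 - (1 / 2) ^ n := by
    intro n
    induction n with
    | zero => simp [matPow]
    | succ n ih =>
      simp only [matPow, Fintype.sum_bool, ih, sum_fin_three_bool,
        deviateI_alwaysTrue_prodMarginal]
      constructor <;> simp [kernel] <;> ring
  have hr : expRew (deviateI 0 alwaysTrue prodMarginal) (reward 0) true = 1 := by
    unfold expRew
    rw [sum_fin_three_bool]
    norm_num [deviateI_alwaysTrue_prodMarginal, reward]
  have hs := (hasSum_geometric_of_lt_one (r := (1 / 2 : ℝ)) (by norm_num) (by norm_num)).sub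
    (hasSum_geometric_of_lt_one (r := (1 / 4 : ℝ)) (by norm_num) (by norm_num))
  rw [vinf_eq_tsum, hr]
  convert hs.tsum_eq using 1
  · refine tsum_congr fun n => ?_
    rw [(hm n).2, mul_one, mul_sub, mul_one, ← mul_pow]
    norm_num
  · norm_num

theorem not_isNEI_prodMarginal {ε : ℝ} (hε : ε < 2 / 3) :
    ¬ IsNEI game.γ game.P game.r game.ρ ε (fun k => marginalI corr k) := by
  intro h
  have h0 : vinfρ (1 / 2) kernel (reward 0) (deviateI 0 alwaysTrue prodMarginal)
      (fun s => if s then 0 else 1) - vinfρ (1 / 2) kernel (reward 0) prodMarginal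
      (fun s => if s then 0 else 1) ≤ ε :=
    h (0 : Fin 3) alwaysTrue fun s =>
      ⟨fun b : Bool => by cases b <;> norm_num [alwaysTrue], by
        change ∑ b : Bool, alwaysTrue s b = 1
        simp [alwaysTrue]⟩
  simp only [vinfρ, Fintype.sum_bool, vinf_deviateI_alwaysTrue, vinf_prodMarginal] at h0
  norm_num at h0
  linarith

theorem isCCEI_corr : IsCCEI game.γ game.P game.r game.ρ 0 corr := by
  intro k π' _
  change vinfρ (1 / 2) kernel (reward k) (deviateI (A := fun _ : Fin 3 => Bool) k π' corr)
    (fun s => if s then 0 else 1) - vinfρ (1 / 2) kernel (reward k) corr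
    (fun s => if s then 0 else 1) ≤ 0
  have h1 := vinf_deviateI_corr k π'
  have h2 := vinf_corr k
  simp only [vinfρ, Fintype.sum_bool]
  rw [h1, h2]
  simp

end CoordinationGame

theorem exists_game_cce_does_not_collapse_discounted :
    ∃ (G : DiscGame) (σ : G.S → (∀ k, G.A k) → ℝ),
      G.γ ∈ Set.Ioo (0 : ℝ) 1 ∧ IsKer G.P ∧ IsRew G.r ∧ IsDist G.ρ ∧
      IsZSPolymatrixI G.r ∧ ¬ SwitchingControlI G.P ∧
      IsStatPol σ ∧ IsCCEI G.γ G.P G.r G.ρ 0 σ ∧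
      ¬ IsNEI G.γ G.P G.r G.ρ 0 (fun k => marginalI σ k) ∧
      ∀ ε : ℝ, ε < 2 / 15 →
        ¬ IsNEI G.γ G.P G.r G.ρ ε (fun k => marginalI σ k) := by
  refine ⟨CoordinationGame.game, CoordinationGame.corr, ?_,
    CoordinationGame.isDist_kernel, CoordinationGame.isRew_reward, ?_,
    CoordinationGame.isZSPolymatrixI_reward, CoordinationGame.not_switchingControlI_kernel,
    CoordinationGame.isDist_corr, CoordinationGame.isCCEI_corr,
    CoordinationGame.not_isNEI_prodMarginal (by norm_num),
    fun ε hε => CoordinationGame.not_isNEI_prodMarginal (by linarith)⟩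
  · norm_num [CoordinationGame.game]
  · refine ⟨fun s : Bool => ?_, ?_⟩
    · change (0 : ℝ) ≤ if s then 0 else 1
      cases s <;> simp
    · change ∑ s : Bool, (if s then (0 : ℝ) else 1) = 1
      simp
end
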